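/- arXiv:0912.0865 — 5 statements merged into one kernel-verified Lean document; each statement's English description precedes it below -/
import Mathlib

section
/- Let G be a finite group and let K ◁ H ≤ G (K a normal subgroup of H, H a subgroup of G). If H is an NR-subgroup of G, then the image HK^G/K^G of H in the quotient G/K^G is an NR-subgroup of G/K^G, where K^G is the normal closure of K in G. -/
/-- A subgroup `H` of `G` is an NR-subgroup if for every subgroup `K ≤ H` that is
normal in `H`, the intersection of the normal closure of `K` in `G` with `H` is `K`. -/
def IsNRSubgroup {G : Type*} [Group G] (H : Subgroup G) : Prop :=
  ∀ K : Subgroup G, K ≤ H → (K.subgroupOf H).Normal →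
    Subgroup.normalClosure (K : Set G) ⊓ H = K

/-- If `K ◁ H ≤ G` and `H` is an NR-subgroup of `G`, then the image `HK^G/K^G` of `H`
in `G/K^G` is an NR-subgroup of `G/K^G`. -/
theorem image_NR_in_quotient_by_normalClosure {G : Type*} [Group G] [Finite G]
    (H K : Subgroup G) (hKH : K ≤ H) (hKnormal : (K.subgroupOf H).Normal)
    (hNR : IsNRSubgroup H) :
    IsNRSubgroup
      (Subgroup.map (QuotientGroup.mk' (Subgroup.normalClosure (K : Set G))) H) := by
  intro M hMH hMnormal
  let π := QuotientGroup.mk' (Subgroup.normalClosure (K : Set G))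
  let L : Subgroup G := M.comap π ⊓ H
  have hLnormal : (L.subgroupOf H).Normal := by
    refine ⟨fun l hl h => ?_⟩
    rw [Subgroup.mem_subgroupOf] at hl ⊢
    refine ⟨?_, (h * l * h⁻¹).2⟩
    have hconj := hMnormal.conj_mem ⟨π l, hMH hl.1⟩ (Subgroup.mem_subgroupOf.2 hl.1)
      ⟨π h, Subgroup.mem_map_of_mem π h.2⟩
    simpa [Subgroup.mem_subgroupOf] using hconj
  have hLclosure := hNR L inf_le_right hLnormal
  have hKL : K ≤ L := fun k hk => by
    refine ⟨?_, hKH hk⟩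
    have hk1 : π k = 1 := (QuotientGroup.eq_one_iff k).2 (Subgroup.subset_normalClosure hk)
    change π k ∈ M
    rw [hk1]
    exact M.one_mem
  have hmap : L.map π = M := by
    refine le_antisymm (Subgroup.map_le_iff_le_comap.2 inf_le_left) fun m hm => ?_
    obtain ⟨h, hh, rfl⟩ := hMH hm
    exact ⟨h, ⟨hm, hh⟩, rfl⟩
  refine le_antisymm ?_ (le_inf Subgroup.subset_normalClosure hMH)
  rintro x ⟨hx, h, hh, rfl⟩
  rw [← hmap, Subgroup.coe_map,
    ← Subgroup.map_normalClosure _ π (QuotientGroup.mk'_surjective _)] at hx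
  obtain ⟨g, hg, hgh⟩ := hx
  have hgh' : g⁻¹ * h ∈ Subgroup.normalClosure (L : Set G) :=
    Subgroup.normalClosure_mono hKL (QuotientGroup.eq.1 hgh)
  have hhL : h ∈ L := by
    rw [← hLclosure]
    exact ⟨by simpa using mul_mem hg hgh', hh⟩
  exact hhL.1
end

section
/- Let G be a finite group and let K be a normal subgroup of G. If every maximal subgroup of G is an NR-subgroup of G, then every maximal subgroup of the quotient group G/K is an NR-subgroup of G/K. -/
/-- If the preimage of `M` under a surjective homomorphism is an NR-subgroup, so is `M`. -/
theorem IsNRSubgroup.of_comap {G H : Type*} [Group G] [Group H] {f : G →* H}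
    (hf : Function.Surjective f) {M : Subgroup H} (hM : IsNRSubgroup (M.comap f)) :
    IsNRSubgroup M := by
  intro L hLM hL
  have hN : ((L.comap f).subgroupOf (M.comap f)).Normal := by
    refine ⟨fun n hn g => ?_⟩
    have hc := hL.conj_mem ⟨f n, n.2⟩ hn ⟨f g, g.2⟩
    simpa [Subgroup.mem_subgroupOf] using hc
  have hC := hM (L.comap f) (Subgroup.comap_mono hLM) hN
  have hker : f.ker ≤ Subgroup.normalClosure (L.comap f : Set G) :=
    (f.ker_le_comap L).trans Subgroup.le_normalClosure
  have hcl : (Subgroup.normalClosure (L : Set H)).comap f =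
      Subgroup.normalClosure (L.comap f : Set G) := by
    rw [← Subgroup.comap_map_eq_self hker, Subgroup.map_normalClosure _ f hf,
      Subgroup.coe_comap, Set.image_preimage_eq _ hf]
  apply Subgroup.comap_injective hf
  rw [Subgroup.comap_inf, hcl, hC]

/-- If every maximal subgroup of a finite group `G` is an NR-subgroup and `K ◁ G`, then
every maximal subgroup of `G/K` is an NR-subgroup of `G/K`. -/
theorem quotient_all_maximal_NR {G : Type*} [Group G] [Finite G]
    (K : Subgroup G) [K.Normal]
    (h : ∀ M : Subgroup G, IsCoatom M → IsNRSubgroup M) :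
    ∀ M : Subgroup (G ⧸ K), IsCoatom M → IsNRSubgroup M := by
  intro M hM
  have hf := QuotientGroup.mk'_surjective K
  exact .of_comap hf (h _ (Subgroup.isCoatom_comap_of_surjective hf hM))
end

section
/- Let G be a finite group and let H be a maximal solvable subgroup of G (i.e., H is solvable and is maximal among solvable subgroups of G, equivalently here: H is solvable and every subgroup properly containing H is not solvable or H is maximal). If H is an NR-subgroup of G, then H = G. -/
section

open Subgroup

universe u

/-- If a Sylow `p`-subgroup `P` satisfies Burnside's condition `N(P) ≤ C(P)`, then `P` normalizes
some Sylow `q`-subgroup, for every prime `q ≠ p`. -/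
lemma Sylow.exists_smul_eq_of_normalizer_le_centralizer {N : Type*} [Group N] [Finite N]
    {p q : ℕ} [Fact p.Prime] [Fact q.Prime]
    (hpq : p ≠ q) (P : Sylow p N) (hP : normalizer (P : Set N) ≤ centralizer (P : Set N)) :
    ∃ Q : Sylow q N, ∀ x ∈ P, x • Q = Q := by
  obtain ⟨Q⟩ := Sylow.nonempty (p := q) (G := N)
  set K := (MonoidHom.transferSylow P hP).ker
  have hQK : (Q : Subgroup N) ≤ K := by
    intro x hx
    have h1 : IsPGroup q ((Q : Subgroup N).map (MonoidHom.transferSylow P hP)) := Q.2.map _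
    have h2 : IsPGroup p ((Q : Subgroup N).map (MonoidHom.transferSylow P hP)) :=
      P.2.to_subgroup _
    have := (IsPGroup.disjoint_of_ne p q hpq _ _ h2 h1)
    rw [disjoint_self] at this
    have h3 := mem_map_of_mem (MonoidHom.transferSylow P hP) hx
    rw [this] at h3
    exact MonoidHom.mem_ker.2 (mem_bot.1 h3)
  have hfr := Sylow.normalizer_sup_eq_top' Q hQK
  have hdvd : Nat.card P ∣ Nat.card (normalizer (Q : Set N)) := by
    have h1 := (MonoidHom.ker_transferSylow_isComplement' P hP).symm.index_eq_card
    have h2 := relIndex_sup_right (normalizer (Q : Set N)) K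
    rw [hfr, relIndex_top_right] at h2
    exact (h1.symm.trans h2) ▸ relIndex_dvd_card _ _
  have hnd : ¬ p ∣ Nat.card (Sylow q N) := by
    rw [Q.card_eq_index_normalizer]
    intro h
    apply P.not_dvd_index
    have h1 := (P : Subgroup N).card_mul_index
    rw [← (normalizer (Q : Set N)).card_mul_index] at h1
    obtain ⟨c, hc⟩ := hdvd
    rw [hc, mul_assoc] at h1
    have := Nat.eq_of_mul_eq_mul_left Nat.card_pos h1
    rw [this]
    exact h.mul_left _
  obtain ⟨R, hR⟩ := P.2.nonempty_fixed_point_of_prime_not_dvd_card (Sylow q N) hnd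
  exact ⟨R, fun x hx => hR ⟨x, hx⟩⟩

/-- A self-normalizing Sylow `p`-subgroup normalizes at most one Sylow `q`-subgroup. -/
lemma Sylow.eq_of_smul_eq_of_normalizer_le {N : Type*} [Group N] [Finite N]
    {p q : ℕ} [Fact p.Prime] [Fact q.Prime]
    (P : Sylow p N) (hP : normalizer (P : Set N) ≤ P) (Q R : Sylow q N)
    (hQ : ∀ x ∈ P, x • Q = Q) (hR : ∀ x ∈ P, x • R = R) : R = Q := by
  obtain ⟨n, rfl⟩ := MulAction.exists_smul_eq N Q R
  have h1 : (P : Subgroup N) ≤ normalizer (Q : Set N) := fun x hx =>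
    Sylow.smul_eq_iff_mem_normalizer.1 (hQ x hx)
  have h2 : (n⁻¹ • P : Sylow p N) ≤ normalizer (Q : Set N) := by
    rintro _ ⟨x, hx, rfl⟩
    refine Sylow.smul_eq_iff_mem_normalizer.1 ?_
    simpa [mul_smul, inv_smul_eq_iff] using hR x hx
  obtain ⟨⟨l, hl⟩, h⟩ := MulAction.exists_smul_eq (normalizer (Q : Set N))
    ((n⁻¹ • P).subtype h2) (P.subtype h1)
  have h3 := Sylow.subtype_injective ((Sylow.smul_subtype h2 ⟨l, hl⟩).symm.trans h)
  rw [Subgroup.mk_smul, smul_smul] at h3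
  have h4 := hQ _ (hP (Sylow.smul_eq_iff_mem_normalizer.1 h3))
  rw [mul_smul, ← eq_inv_smul_iff, Sylow.smul_eq_iff_mem_normalizer.2 (inv_mem hl),
    inv_smul_eq_iff] at h4
  exact h4.symm

/-- A self-normalizing `p`-subgroup is a Sylow subgroup. -/
lemma IsPGroup.exists_sylow_eq_of_normalizer_le {N : Type*} [Group N] [Finite N]
    {p : ℕ} [Fact p.Prime] {A : Subgroup N}
    (hA : IsPGroup p A) (h : normalizer (A : Set N) ≤ A) :
    ∃ P : Sylow p N, (P : Subgroup N) = A := by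
  obtain ⟨P, hAP⟩ := hA.exists_le_sylow
  refine ⟨P, le_antisymm ?_ hAP⟩
  have := P.2.isNilpotent
  rw [← subgroupOf_eq_top]
  apply normalizerCondition_iff_only_full_group_self_normalizing.1
    Group.normalizerCondition_of_isNilpotent
  rw [← subgroupOf_normalizer_eq hAP, le_antisymm h le_normalizer]

lemma Subgroup.isSolvable_sup_of_le_normalizer {G : Type*} [Group G] {H Q : Subgroup G}
    (hH : Group.IsSolvable H) (hQ : Group.IsSolvable Q)
    (h : H ≤ normalizer (Q : Set G)) : Group.IsSolvable (H ⊔ Q : Subgroup G) := by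
  have := normal_subgroupOf_of_le_normalizer h
  have := normal_subgroupOf_sup_of_le_normalizer h
  refine (Group.isSolvable_iff_subgroup_quotient (Q.subgroupOf (H ⊔ Q))).2 ⟨?_, ?_⟩
  · exact Group.isSolvable_of_isSolvable_injective
      (f := (subgroupOfEquivOfLe (le_sup_right : Q ≤ H ⊔ Q)).toMonoidHom)
      (MulEquiv.injective _)
  · exact Group.isSolvable_of_surjective
      (f := (QuotientGroup.quotientInfEquivProdNormalizerQuotient H Q h).toMonoidHom)
      (MulEquiv.surjective _)

/-- Let `H` be a maximal solvable subgroup. An abelian `p`-subgroup whose normalizer is `H` and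
whose normal closure meets `H` in itself is normal. -/
lemma Subgroup.normal_of_normalizer_eq_maximal_solvable {G : Type*} [Group G] [Finite G]
    {p : ℕ} [Fact p.Prime]
    {H B : Subgroup G} (hsolv : Group.IsSolvable H)
    (hmax : ∀ H' : Subgroup G, Group.IsSolvable H' → H ≤ H' → H' = H)
    (hB : IsPGroup p B) (hBc : B ≤ centralizer (B : Set G))
    (hH : normalizer (B : Set G) = H)
    (hNR : normalClosure (B : Set G) ⊓ H = B) : B.Normal := by
  set N := normalClosure (B : Set G)
  have hBN : B ≤ N := le_normalClosure
  have hA : IsPGroup p (B.subgroupOf N) := hB.comap_subtype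
  have hself : normalizer (B.subgroupOf N : Set N) ≤ B.subgroupOf N := by
    rw [← subgroupOf_normalizer_eq hBN, hH]
    exact fun x hx => hNR.le ⟨x.2, hx⟩
  obtain ⟨P, hP⟩ := IsPGroup.exists_sylow_eq_of_normalizer_le hA hself
  have hPs : normalizer (P : Set N) ≤ P := by
    rw [← Sylow.coe_coe, hP]; exact hself
  have hPc : normalizer (P : Set N) ≤ centralizer (P : Set N) := by
    refine hPs.trans ?_
    rw [← Sylow.coe_coe, hP]
    exact fun x hx y hy => Subtype.ext (hBc hx y hy)
  have hq : ∀ q : ℕ, q.Prime → q ∣ Nat.card N → q = p := by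
    intro q hq hqN
    by_contra hne
    have := Fact.mk hq
    obtain ⟨Q, hQ⟩ := Sylow.exists_smul_eq_of_normalizer_le_centralizer (Ne.symm hne) P hPc
    have hinv : ∀ h ∈ H, (MulAut.conjNormal h : MulAut N) • Q = Q := by
      intro h hh
      refine Sylow.eq_of_smul_eq_of_normalizer_le P hPs _ _ hQ fun x hx => ?_
      set φ : MulAut N := MulAut.conjNormal h
      have hy : φ⁻¹ x ∈ P := by
        rw [← SetLike.mem_coe, ← Sylow.coe_coe, hP] at hx ⊢
        have h1 : h⁻¹ ∈ normalizer (B : Set G) := inv_mem (hH.ge hh)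
        have h2 := (mem_normalizer_iff.1 h1 x).1 hx
        rw [SetLike.mem_coe, mem_subgroupOf, ← map_inv, MulAut.conjNormal_apply]
        exact h2
      have hconj : MulAut.conj x * φ = φ * MulAut.conj (φ⁻¹ x) := by
        ext z
        simp [MulAut.mul_apply]
      rw [Sylow.smul_def, smul_smul, hconj, mul_smul, ← Sylow.smul_def, hQ _ hy]
    have hn : H ≤ normalizer ((Q : Subgroup N).map N.subtype : Set G) := by
      have hmem : ∀ h ∈ H, ∀ x ∈ (Q : Subgroup N).map N.subtype,
          h * x * h⁻¹ ∈ (Q : Subgroup N).map N.subtype := by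
        rintro h hh _ ⟨y, hy, rfl⟩
        refine ⟨MulAut.conjNormal h y, ?_, MulAut.conjNormal_apply h y⟩
        rw [← hinv h hh]
        exact ⟨y, hy, rfl⟩
      refine fun h hh => mem_normalizer_iff.2 fun x => ⟨hmem h hh x, fun hx => ?_⟩
      simpa [mul_assoc] using hmem h⁻¹ (inv_mem hh) _ hx
    have hQs : Group.IsSolvable ((Q : Subgroup N).map N.subtype) := by
      have := (Q.2.map N.subtype).isNilpotent
      infer_instance
    have hle : (Q : Subgroup N) ≤ P := by
      have := hmax _ (Subgroup.isSolvable_sup_of_le_normalizer hsolv hQs hn) le_sup_left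
      rw [hP, subgroupOf, ← map_le_iff_le_comap]
      exact (le_inf (map_subtype_le _) (this ▸ le_sup_right)).trans hNR.le
    apply Q.ne_bot_of_dvd_card hqN
    have := IsPGroup.disjoint_of_ne q p hne _ _ Q.2 P.2
    exact this.eq_bot_of_le hle
  have hNp : IsPGroup p N := IsPGroup.of_card
    (Nat.eq_prime_pow_of_unique_prime_dvd Nat.card_pos.ne' (fun {d} => hq d))
  have htop : (P : Subgroup N) = ⊤ := (P.3 (hNp.to_subgroup ⊤) le_top).symm
  rw [hP, subgroupOf_eq_top] at htop
  rw [le_antisymm hBN htop]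
  exact normalClosure_normal

lemma Group.IsSolvable.exists_normal_abelian_pSubgroup {S : Type*} [Group S] [Finite S] [Nontrivial S]
    [Group.IsSolvable S] :
    ∃ p : ℕ, p.Prime ∧ ∃ B : Subgroup S, B.Normal ∧ IsPGroup p B ∧ B ≠ ⊥ ∧
      B ≤ centralizer (B : Set S) := by
  classical
  have hex := (Group.isSolvable_def S).1 inferInstance
  obtain ⟨A, hAc, hA, hA1⟩ : ∃ A : Subgroup S, A.Normal ∧ A ≠ ⊥ ∧ ⁅A, A⁆ = ⊥ := by
    obtain ⟨n, hn⟩ : ∃ n, Nat.find hex = n + 1 := Nat.exists_eq_succ_of_ne_zero fun h => by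
      have := Nat.find_spec hex
      rw [h, derivedSeries_zero] at this
      exact top_ne_bot this
    exact ⟨derivedSeries S n, inferInstance, Nat.find_min hex (by omega),
      by rw [← derivedSeries_succ, ← hn]; exact Nat.find_spec hex⟩
  rw [commutator_eq_bot_iff_le_centralizer] at hA1
  obtain ⟨p, hp, hpA⟩ := Nat.exists_prime_and_dvd (mt (card_eq_one).1 hA)
  have := Fact.mk hp
  obtain ⟨P⟩ := Sylow.nonempty (p := p) (G := A)
  have hPn : (P : Subgroup A).Normal :=
    ⟨fun x hx y => by
      rwa [show y * x = x * y from Subtype.ext (hA1 x.2 y y.2), mul_inv_cancel_right]⟩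
  have := P.characteristic_of_normal hPn
  refine ⟨p, hp, (P : Subgroup A).map A.subtype, inferInstance, P.2.map _, ?_, ?_⟩
  · rw [Ne, map_eq_bot_iff_of_injective _ A.subtype_injective]
    exact P.ne_bot_of_dvd_card hpA
  · exact fun x hx y hy => hA1 (map_subtype_le _ hx) y (map_subtype_le _ hy)

lemma IsNRSubgroup.subgroupOf {G : Type*} [Group G] {H M : Subgroup G} (hHM : H ≤ M)
    (hNR : IsNRSubgroup H) :
    IsNRSubgroup (H.subgroupOf M) := by
  intro K hK hKn
  refine le_antisymm ?_ (le_inf le_normalClosure hK)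
  have hKH : K.map M.subtype ≤ H := map_le_iff_le_comap.2 hK
  have hL : ((K.map M.subtype).subgroupOf H).Normal := by
    rw [normal_subgroupOf_iff hK] at hKn
    rw [normal_subgroupOf_iff hKH]
    rintro _ n ⟨x, hx, rfl⟩ hn
    exact ⟨_, hKn x ⟨n, hHM hn⟩ hx hn, rfl⟩
  have hle : normalClosure (K : Set M) ≤
      (normalClosure (K.map M.subtype : Set G)).comap M.subtype :=
    normalClosure_le_normal fun x hx => subset_normalClosure (mem_map_of_mem M.subtype hx)
  intro x hx
  have := (hNR _ hKH hL).le ⟨hle hx.1, hx.2⟩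
  exact (mem_map_iff_mem M.subtype_injective).1 this

lemma IsNRSubgroup.map_mk {G : Type*} [Group G] {H B : Subgroup G} [B.Normal] (hBH : B ≤ H)
    (hNR : IsNRSubgroup H) : IsNRSubgroup (H.map (QuotientGroup.mk' B)) := by
  intro K hK hKn
  set π := QuotientGroup.mk' B
  have hπ : Function.Surjective π := QuotientGroup.mk'_surjective B
  have hker : π.ker = B := QuotientGroup.ker_mk' B
  have hcH : (H.map π).comap π = H := comap_map_eq_self (hker.le.trans hBH)
  have hLH : K.comap π ≤ H := (comap_mono hK).trans hcH.le
  have hL : ((K.comap π).subgroupOf H).Normal := by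
    rw [normal_subgroupOf_iff hK] at hKn
    rw [normal_subgroupOf_iff hLH]
    intro x n hx hn
    simpa using hKn (π x) (π n) hx (mem_map_of_mem π hn)
  have hKer : π.ker ≤ normalClosure (K.comap π : Set G) :=
    (comap_mono (f := π) bot_le).trans le_normalClosure
  have hmap : normalClosure (K : Set (G ⧸ B)) = (normalClosure (K.comap π : Set G)).map π := by
    rw [map_normalClosure _ _ hπ, coe_comap, Set.image_preimage_eq _ hπ]
  apply comap_injective hπ
  rw [comap_inf, hcH, hmap, comap_map_eq_self hKer, hNR _ hLH hL]

lemma maximal_solvable_NR_eq_top_of_card_eq (n : ℕ) :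
    ∀ {G : Type u} [Group G] [Finite G], Nat.card G = n →
    ∀ H : Subgroup G, Group.IsSolvable H →
    (∀ H' : Subgroup G, Group.IsSolvable H' → H ≤ H' → H' = H) →
    IsNRSubgroup H → H = ⊤ := by
  induction n using Nat.strong_induction_on with
  | _ n ih =>
  intro G _ _ hn H hsolv hmax hNR
  rcases subsingleton_or_nontrivial H with hs | hs
  · refine top_le_iff.1 fun g _ => ?_
    have hH : H = ⊥ := H.eq_bot_of_subsingleton
    have := hmax (zpowers g) inferInstance (hH.le.trans bot_le)
    exact this ▸ mem_zpowers g
  obtain ⟨p, hp, B₀, hB₀n, hB₀p, hB₀, hB₀c⟩ :=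
    Group.IsSolvable.exists_normal_abelian_pSubgroup (S := H)
  have := Fact.mk hp
  obtain ⟨B, hBH, rfl⟩ : ∃ B ≤ H, B₀ = B.subgroupOf H :=
    ⟨B₀.map H.subtype, map_subtype_le _, (comap_map_eq_self_of_injective H.subtype_injective _).symm⟩
  have hHB : H ≤ normalizer (B : Set G) := (normal_subgroupOf_iff_le_normalizer hBH).1 hB₀n
  have hBp : IsPGroup p B := hB₀p.of_equiv (subgroupOfEquivOfLe hBH)
  have hBc : B ≤ centralizer (B : Set G) := fun x hx y hy =>
    congrArg Subtype.val (hB₀c (x := ⟨x, hBH hx⟩) hx ⟨y, hBH hy⟩ hy)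
  have hB : B ≠ ⊥ := by
    rintro rfl
    exact hB₀ (bot_subgroupOf H)
  have hBnorm : B.Normal := by
    rw [← normalizer_eq_top_iff]
    by_contra hne
    have hlt : Nat.card (normalizer (B : Set G)) < n := by
      rw [← hn]
      exact lt_of_le_of_ne (card_le_card_group _) (mt (card_eq_iff_eq_top _).1 hne)
    have h1 := ih _ hlt rfl (H.subgroupOf (normalizer (B : Set G)))
      (Group.isSolvable_of_isSolvable_injective (f := (subgroupOfEquivOfLe hHB).toMonoidHom)
        (MulEquiv.injective _)) ?_ (IsNRSubgroup.subgroupOf hHB hNR)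
    · have h2 := le_antisymm (subgroupOf_eq_top.1 h1) hHB
      exact hne (normalizer_eq_top_iff.2 (normal_of_normalizer_eq_maximal_solvable hsolv hmax hBp hBc h2
        (hNR B hBH hB₀n)))
    · intro M hM hHM
      have h3 := hmax (M.map (normalizer (B : Set G)).subtype)
        (Group.isSolvable_of_surjective (MonoidHom.subgroupMap_surjective _ M)) ?_
      · rw [← h3]
        exact (comap_map_eq_self_of_injective (subtype_injective _) _).symm
      · exact fun x hx => ⟨⟨x, hHB hx⟩, hHM hx, rfl⟩
  set π := QuotientGroup.mk' B
  have hπ : Function.Surjective π := QuotientGroup.mk'_surjective B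
  have hker : π.ker = B := QuotientGroup.ker_mk' B
  have hcH : (H.map π).comap π = H := comap_map_eq_self (hker.le.trans hBH)
  have hlt : Nat.card (G ⧸ B) < n := by
    rw [← hn, ← B.index_mul_card]
    exact lt_mul_of_one_lt_right Nat.card_pos ((one_lt_card_iff_ne_bot B).2 hB)
  have h1 := ih _ hlt rfl (H.map π)
    (Group.isSolvable_of_surjective (MonoidHom.subgroupMap_surjective π H)) ?_ (IsNRSubgroup.map_mk hBH hNR)
  · rw [← hcH, h1, comap_top]
  · intro M hM hHM
    have hBM : B ≤ M.comap π := hker.ge.trans (comap_mono bot_le)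
    have hBs : Group.IsSolvable B :=
      Group.isSolvable_of_isSolvable_injective (inclusion_injective hBH)
    have hs : Group.IsSolvable (M.comap π) := by
      refine Group.isSolvable_of_ker_le_range (inclusion hBM) (π.subgroupComap M) ?_
      intro x hx
      refine ⟨⟨x, ?_⟩, rfl⟩
      exact hker.le (congrArg Subtype.val hx)
    rw [← map_comap_eq_self_of_surjective hπ M, hmax _ hs (map_le_iff_le_comap.1 hHM)]

end

/-- If `H` is a maximal solvable subgroup of the finite group `G` (i.e. `H` is solvable
and maximal among the solvable subgroups of `G`) and `H` is an NR-subgroup of `G`,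
then `H = G`. -/
theorem maximal_solvable_NR_eq_top {G : Type*} [Group G] [Finite G]
    (H : Subgroup G) (hsolv : IsSolvable H)
    (hmax : ∀ H' : Subgroup G, IsSolvable H' → H ≤ H' → H' = H)
    (hNR : IsNRSubgroup H) : H = ⊤ := by
  exact maximal_solvable_NR_eq_top_of_card_eq _ rfl H hsolv hmax hNR
end

section
/- Let G be a nonabelian finite simple group and let M be a proper subgroup of G which is an NR-subgroup of G. Then every nontrivial normal subgroup K of M equals M; in other words, M has no nontrivial proper normal subgroups. -/
/-- If `G` is a nonabelian finite simple group and `M` is a proper NR-subgroup of `G`,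
then every nontrivial normal subgroup of `M` equals `M`. -/
theorem NR_subgroup_of_simple_has_no_proper_normal {G : Type*} [Group G] [Finite G]
    [IsSimpleGroup G] (hna : ∃ a b : G, a * b ≠ b * a)
    (M : Subgroup G) (hM : M ≠ ⊤) (hNR : IsNRSubgroup M) :
    ∀ K : Subgroup G, K ≤ M → (K.subgroupOf M).Normal → K ≠ ⊥ → K = M := by
  intro K hKM hK hK0
  have h := hNR K hKM hK
  rcases (Subgroup.normalClosure_normal (s := (K : Set G))).eq_bot_or_eq_top with hb | ht
  · exact absurd (le_bot_iff.mp (hb ▸ Subgroup.le_normalClosure)) hK0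
  · rw [← h, ht, top_inf_eq]
end

section
/- Let G be a finite group, N the unique minimal normal subgroup of G, and M a maximal subgroup of G which is an NR-subgroup of G and satisfies G = MN. Then every nontrivial normal subgroup L of M contains M ∩ N; in particular, if M ∩ N is nontrivial then M ∩ N is a minimal normal subgroup of M. -/
/-- Let `N` be the unique minimal normal subgroup of the finite group `G`, and let `M` be
a maximal subgroup of `G` which is an NR-subgroup and satisfies `G = MN`.  Then every
nontrivial normal subgroup `L` of `M` contains `M ⊓ N`; in particular, if `M ⊓ N` is
nontrivial then `M ⊓ N` is a minimal normal subgroup of `M`. -/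
theorem inter_min_normal_of_NR_maximal {G : Type*} [Group G] [Finite G]
    (N : Subgroup G) (hNnormal : N.Normal) (hNbot : N ≠ ⊥)
    (hNunique : ∀ L : Subgroup G, L.Normal → L ≠ ⊥ → N ≤ L)
    (M : Subgroup G) (hMmax : IsCoatom M) (hMNR : IsNRSubgroup M)
    (hMN : ∀ g : G, ∃ m ∈ M, ∃ n ∈ N, g = m * n) :
    (∀ L : Subgroup G, L ≤ M → (L.subgroupOf M).Normal → L ≠ ⊥ → M ⊓ N ≤ L) ∧
    (M ⊓ N ≠ ⊥ → ((M ⊓ N).subgroupOf M).Normal ∧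
      (∀ L : Subgroup G, L ≤ M → (L.subgroupOf M).Normal → L ≠ ⊥ → L ≤ M ⊓ N →
        L = M ⊓ N)) := by
  have key : ∀ L : Subgroup G, L ≤ M → (L.subgroupOf M).Normal → L ≠ ⊥ → M ⊓ N ≤ L := by
    intro L hLM hL hLbot x hx
    have hclosure : Subgroup.normalClosure (L : Set G) ≠ ⊥ := fun h =>
      hLbot (le_bot_iff.mp (h ▸ Subgroup.le_normalClosure))
    rw [← hMNR L hLM hL]
    exact ⟨hNunique _ Subgroup.normalClosure_normal hclosure hx.2, hx.1⟩
  refine ⟨key, fun _ => ⟨?_, fun L hLM hL hLbot hLe => le_antisymm hLe (key L hLM hL hLbot)⟩⟩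
  rw [Subgroup.inf_subgroupOf_left]
  infer_instance
end
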